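/- Suppose Γ is finite and Assumption (E0) holds. Let H : Γ ⇉ Γ be a set-valued map and let T be a family of forward complete trajectories of the switched system ẋ = f(x,σ) such that σ ∈ S_d ∩ S^H for every (x,σ) ∈ T. Then T is locally asymptotically stable (LAS) if one of the following holds: (1) there exists a weak Lyapunov pair (V,W) for T such that (i) either O_γ^f(f_γ,W_γ,∞) ⊆ {0} for every γ ∈ Γ or O_γ^b(f_γ,W_γ,∞) ⊆ {0} for every γ ∈ Γ, and (iii) for every c ∈ ℝ and each simple cycle {γ_i}_{i=1}^m of H there exists j ∈ {1,…,m−1} with O_{γ_j}^b(f_{γ_j},W_{γ_j}) ∩ O_{γ_{j+1}}^f(f_{γ_{j+1}},W_{γ_{j+1}}) ∩ V_{γ_j}⁻¹(c) ∩ V_{γ_{j+1}}⁻¹(c) ⊆ {0}; (2) there exists an F-weak Lyapunov pair (V,W) for T such that (i) holds and (ii) for each simple cycle {γ_i}_{i=1}^m of H there exists j ∈ {1,…,m−1} with O_{γ_j}^b(f_{γ_j},W_{γ_j}) ∩ O_{γ_{j+1}}^f(f_{γ_{j+1}},W_{γ_{j+1}}) ⊆ {0}. If, in addition, O = ℝⁿ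 and V is radially unbounded, then T is globally asymptotically stable (GAS). -/

import Mathlib

open Filter Topology MeasureTheory Set

noncomputable section

abbrev Eucl (n : ℕ) : Type := EuclideanSpace ℝ (Fin n)

/-- The set of discontinuity (switching) times of a signal. -/
def JumpTimes {Γ : Type*} [TopologicalSpace Γ] (σ : ℝ → Γ) : Set ℝ :=
  {t | ¬ ContinuousAt σ t}

/-- A switching signal: piecewise constant (finitely many discontinuities in every
compact interval, locally constant to the right and on a left punctured neighborhood
of every point) and continuous from the right. -/
structure IsSwitchingSignal {Γ : Type*} [TopologicalSpace Γ] (σ : ℝ → Γ) : Prop where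
  locFinite : ∀ a b : ℝ, (JumpTimes σ ∩ Set.Icc a b).Finite
  rightConst : ∀ t : ℝ, ∃ ε > (0:ℝ), ∀ s ∈ Set.Ico t (t + ε), σ s = σ t
  leftConst : ∀ t : ℝ, ∃ ε > (0:ℝ), ∀ s ∈ Set.Ioo (t - ε) t, ∀ s' ∈ Set.Ioo (t - ε) t, σ s = σ s'

/-- `SA Γ τD N₀` : switching signals with average dwell time `τD` and chatter bound `N₀`. -/
def SA (Γ : Type*) [TopologicalSpace Γ] (τD : ℝ) (N₀ : ℕ) : Set (ℝ → Γ) :=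
  {σ | IsSwitchingSignal σ ∧ ∀ τ₁ τ₂ : ℝ, τ₁ < τ₂ →
    ((JumpTimes σ ∩ Set.Ioo τ₁ τ₂).ncard : ℝ) ≤ (N₀ : ℝ) + (τ₂ - τ₁) / τD}

def SAall (Γ : Type*) [TopologicalSpace Γ] : Set (ℝ → Γ) :=
  ⋃ τD ∈ Set.Ioi (0 : ℝ), ⋃ N₀ : ℕ, SA Γ τD N₀

/-- Dwell-time signals. -/
def SD (Γ : Type*) [TopologicalSpace Γ] (τD : ℝ) : Set (ℝ → Γ) := SA Γ τD 1

def SDall (Γ : Type*) [TopologicalSpace Γ] : Set (ℝ → Γ) :=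
  ⋃ τD ∈ Set.Ioi (0 : ℝ), SD Γ τD

/-- First switching time strictly greater than `t` (`⊤` if none). -/
def tau1 {Γ : Type*} [TopologicalSpace Γ] (σ : ℝ → Γ) (t : ℝ) : EReal :=
  sInf (Real.toEReal '' (JumpTimes σ ∩ Set.Ioi t))

/-- The class `S^H` of switching signals compatible with the set-valued map `H`:
at each switching time the new value belongs to `H` of the left limit. -/
def SH {Γ : Type*} [TopologicalSpace Γ] (H : Γ → Set Γ) : Set (ℝ → Γ) :=
  {σ | ∀ t ∈ JumpTimes σ, ∀ γ' : Γ,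
    Filter.Tendsto σ (nhdsWithin t (Set.Iio t)) (nhds γ') → σ t ∈ H γ'}

/-- The "ergodic" class `S_e[T]`. -/
def SE (Γ : Type*) [TopologicalSpace Γ] (T : ℝ) : Set (ℝ → Γ) :=
  {σ | ∀ t₀ : ℝ, 0 ≤ t₀ → ∀ γ : Γ, ∃ t ∈ Set.Icc t₀ (t₀ + T), σ t = γ}

def SEall (Γ : Type*) [TopologicalSpace Γ] : Set (ℝ → Γ) :=
  ⋃ T ∈ Set.Ioi (0 : ℝ), SE Γ T

/-- Property P of a family of switching signals. -/
def HasPropertyP {Γ : Type*} [TopologicalSpace Γ] (S : Set (ℝ → Γ)) : Prop :=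
  (∃ τD > (0 : ℝ), ∃ N₀ : ℕ, S ⊆ SA Γ τD N₀) ∧
  (∀ σ ∈ S, ∀ s > (0 : ℝ), (fun t => σ (t + s)) ∈ S) ∧
  (∀ σseq : ℕ → ℝ → Γ, (∀ k, σseq k ∈ S) →
    ∃ σstar ∈ S, ∃ φ : ℕ → ℕ, StrictMono φ ∧
      ∀ᵐ t ∂(volume : Measure ℝ),
        Filter.Tendsto (fun l => σseq (φ l) t) Filter.atTop (nhds (σstar t)))

/-- A solution of `ẋ = g(x)` with values in `X`, on the set `I`. -/
def IsSolOn {n : ℕ} (g : Eucl n → Eucl n) (X : Set (Eucl n)) (φ : ℝ → Eucl n) (I : Set ℝ) : Prop :=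
  ContinuousOn φ I ∧ (∀ t ∈ I, φ t ∈ X) ∧
  ∀ t₀ ∈ I, ∀ t ∈ I,
    IntervalIntegrable (fun s => g (φ s)) volume t₀ t ∧
    φ t = φ t₀ + ∫ s in t₀..t, g (φ s)

/-- A trajectory of the switched system `ẋ = f(x,σ)` on the interval `I`. -/
structure IsTrajectory {n : ℕ} {Γ : Type*} [TopologicalSpace Γ]
    (f : Eucl n × Γ → Eucl n) (domf : Set (Eucl n × Γ))
    (x : ℝ → Eucl n) (σ : ℝ → Γ) (I : Set ℝ) : Prop where
  signal : IsSwitchingSignal σ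
  nonempty : I.Nonempty
  ordConn : I.OrdConnected
  cont : ContinuousOn x I
  mem : ∀ t ∈ I, (x t, σ t) ∈ domf
  intg : ∀ t₀ ∈ I, ∀ t ∈ I,
    IntervalIntegrable (fun s => f (x s, σ s)) volume t₀ t ∧
    x t = x t₀ + ∫ s in t₀..t, f (x s, σ s)

/-- Precompactness of a trajectory relative to `O`. -/
def PrecompactRel {n : ℕ} (x : ℝ → Eucl n) (I : Set ℝ) (O : Set (Eucl n)) : Prop :=
  ∃ B : Set (Eucl n), B ⊆ O ∧ IsCompact B ∧ ∀ t ∈ I, x t ∈ B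

/-- ω-limit set of `x` defined on `I`. -/
def OmegaLimit {n : ℕ} (x : ℝ → Eucl n) (I : Set ℝ) : Set (Eucl n) :=
  {ξ | ∃ s : ℕ → ℝ, StrictMono s ∧ (∀ k, s k ∈ I) ∧
    Filter.Tendsto s Filter.atTop Filter.atTop ∧
    Filter.Tendsto (fun k => x (s k)) Filter.atTop (nhds ξ)}

/-- The set `Ω♯(x,σ)`. -/
def OmegaSharp {n : ℕ} {Γ : Type*} [TopologicalSpace Γ] (x : ℝ → Eucl n) (σ : ℝ → Γ) :
    Set (Eucl n × Γ) :=
  {p | ∃ s : ℕ → ℝ, StrictMono s ∧ (∀ k, 0 ≤ s k) ∧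
    Filter.Tendsto s Filter.atTop Filter.atTop ∧
    (∃ r : EReal, 0 < r ∧
      Filter.Tendsto (fun k => tau1 σ (s k) - Real.toEReal (s k)) Filter.atTop (nhds r)) ∧
    Filter.Tendsto (fun k => x (s k)) Filter.atTop (nhds p.1) ∧
    Filter.Tendsto (fun k => σ (s k)) Filter.atTop (nhds p.2)}

/-- Weak invariance of `M` w.r.t. the family of complete trajectories `T`
(without the nonemptiness requirement). -/
def WeaklyInvariantCore {n : ℕ} {Γ : Type*} (T : Set ((ℝ → Eucl n) × (ℝ → Γ)))
    (M : Set (Eucl n × Γ)) : Prop :=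
  ∀ p ∈ M, ∃ xs ∈ T, xs.1 0 = p.1 ∧ xs.2 0 = p.2 ∧ ∀ t : ℝ, (xs.1 t, xs.2 t) ∈ M

/-- Weak invariance of a nonempty set `M` w.r.t. `T`. -/
def WeaklyInvariant {n : ℕ} {Γ : Type*} (T : Set ((ℝ → Eucl n) × (ℝ → Γ)))
    (M : Set (Eucl n × Γ)) : Prop :=
  M.Nonempty ∧ WeaklyInvariantCore T M

/-- Maximal weakly invariant subset of `S` w.r.t. `T`. -/
def MaxWeaklyInvariantIn {n : ℕ} {Γ : Type*} (T : Set ((ℝ → Eucl n) × (ℝ → Γ)))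
    (S : Set (Eucl n × Γ)) : Set (Eucl n × Γ) :=
  ⋃₀ {M | M ⊆ S ∧ WeaklyInvariantCore T M}

/-- All complete trajectories whose switching signal lies in `S`. -/
def TrajOf {n : ℕ} {Γ : Type*} [TopologicalSpace Γ] (f : Eucl n × Γ → Eucl n)
    (domf : Set (Eucl n × Γ)) (S : Set (ℝ → Γ)) : Set ((ℝ → Eucl n) × (ℝ → Γ)) :=
  {xs | IsTrajectory f domf xs.1 xs.2 Set.univ ∧ xs.2 ∈ S}

/-- `x → M` : convergence of `x(t)` to the set `M` as `t → +∞`. -/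
def ConvergesTo {n : ℕ} (x : ℝ → Eucl n) (M : Set (Eucl n)) : Prop :=
  Filter.Tendsto (fun t => Metric.infDist (x t) M) Filter.atTop (nhds 0)

def Oset {n : ℕ} {Γ : Type*} (domV : Set (Eucl n × Γ)) : Set (Eucl n) := Prod.fst '' domV

def Ogamma {n : ℕ} {Γ : Type*} (domV domf : Set (Eucl n × Γ)) (γ : Γ) : Set (Eucl n) :=
  {ξ | ξ ∈ Oset domV ∧ (ξ, γ) ∈ domf}

/-- The class 𝒱 of functions. -/
structure ClassVFun {n : ℕ} {Γ : Type*} (V : Eucl n × Γ → ℝ)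
    (domV domf : Set (Eucl n × Γ)) : Prop where
  openD : ∀ γ : Γ, IsOpen {ξ : Eucl n | (ξ, γ) ∈ domV}
  subD : ∀ γ : Γ, ∀ ξ ∈ Ogamma domV domf γ, (ξ, γ) ∈ domV
  diff : ∀ γ : Γ, ∀ ξ ∈ Ogamma domV domf γ, DifferentiableAt ℝ (fun ξ' => V (ξ', γ)) ξ

/-- The set `Z_V`. -/
def ZV {n : ℕ} {Γ : Type*} (f : Eucl n × Γ → Eucl n) (V : Eucl n × Γ → ℝ)
    (domV domf : Set (Eucl n × Γ)) : Set (Eucl n × Γ) :=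
  {p | p ∈ domf ∧ p.1 ∈ Oset domV ∧ fderiv ℝ (fun ξ' => V (ξ', p.2)) p.1 (f p) = 0}

/-- Assumption (A1). -/
structure AssumptionA1 {n : ℕ} {Γ : Type*} [TopologicalSpace Γ]
    (domf : Set (Eucl n × Γ)) (V : Eucl n × Γ → ℝ) (domV : Set (Eucl n × Γ))
    (x : ℝ → Eucl n) (σ : ℝ → Γ) (I : Set ℝ) : Prop where
  classV : ClassVFun V domV domf
  contV : ContinuousOn V (domf ∩ (Oset domV ×ˢ (Set.univ : Set Γ)))
  precompact : PrecompactRel x I (Oset domV)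
  nonincr : AntitoneOn (fun t => V (x t, σ t)) (Set.Ici 0)

/-- Assumption (A2) (for finite Γ). -/
structure AssumptionA2 {n : ℕ} {Γ : Type*} [TopologicalSpace Γ]
    (domf : Set (Eucl n × Γ)) (V : Eucl n × Γ → ℝ) (domV : Set (Eucl n × Γ))
    (x : ℝ → Eucl n) (σ : ℝ → Γ) (I : Set ℝ) : Prop where
  classV : ClassVFun V domV domf
  precompact : PrecompactRel x I (Oset domV)
  nonincr : ∀ γ : Γ, AntitoneOn (fun t => V (x t, σ t)) ({t | σ t = γ} ∩ Set.Ici 0)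

/-- The inequality `−∇V_γ(ξ)·f_γ(ξ) ≥ W_γ(ξ) ≥ 0` on each `O_γ`. -/
def Wineq {n : ℕ} {Γ : Type*} (f : Eucl n × Γ → Eucl n) (V W : Eucl n × Γ → ℝ)
    (domV domf : Set (Eucl n × Γ)) : Prop :=
  ∀ γ : Γ, ∀ ξ ∈ Ogamma domV domf γ,
    W (ξ, γ) ≤ -(fderiv ℝ (fun ξ' => V (ξ', γ)) ξ (f (ξ, γ))) ∧ 0 ≤ W (ξ, γ)

/-- Assumption (A4). -/
structure AssumptionA4 {n : ℕ} {Γ : Type*} [TopologicalSpace Γ] (f : Eucl n × Γ → Eucl n)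
    (domf : Set (Eucl n × Γ)) (V : Eucl n × Γ → ℝ) (domV : Set (Eucl n × Γ))
    (W : Eucl n × Γ → ℝ) (x : ℝ → Eucl n) (σ : ℝ → Γ) (I : Set ℝ) : Prop where
  classV : ClassVFun V domV domf
  boundedV : ∀ K : Set (Eucl n × Γ), K ⊆ domf ∩ (Oset domV ×ˢ (Set.univ : Set Γ)) →
    IsCompact K → ∃ M : ℝ, ∀ p ∈ K, |V p| ≤ M
  precompact : PrecompactRel x I (Oset domV)
  nonincr : AntitoneOn (fun t => V (x t, σ t)) (Set.Ici 0)
  wineq : Wineq f V W domV domf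
  contW : ContinuousOn W (domf ∩ (Oset domV ×ˢ (Set.univ : Set Γ)))

/-- The set `X^f(g,h,τ)` for finite `τ`. -/
def XFwd {n : ℕ} (X : Set (Eucl n)) (g : Eucl n → Eucl n) (h : Eucl n → ℝ) (τ : ℝ) :
    Set (Eucl n) :=
  {ξ | ∃ φ : ℝ → Eucl n, IsSolOn g X φ (Set.Icc 0 τ) ∧ φ 0 = ξ ∧
    ∀ t ∈ Set.Icc (0 : ℝ) τ, h (φ t) = 0}

/-- The set `X^b(g,h,τ)` for finite `τ`. -/
def XBwd {n : ℕ} (X : Set (Eucl n)) (g : Eucl n → Eucl n) (h : Eucl n → ℝ) (τ : ℝ) :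
    Set (Eucl n) :=
  {ξ | ∃ φ : ℝ → Eucl n, IsSolOn g X φ (Set.Icc (-τ) 0) ∧ φ 0 = ξ ∧
    ∀ t ∈ Set.Icc (-τ) (0 : ℝ), h (φ t) = 0}

/-- The set `X^f(g,h,∞)`. -/
def XFwdInf {n : ℕ} (X : Set (Eucl n)) (g : Eucl n → Eucl n) (h : Eucl n → ℝ) :
    Set (Eucl n) :=
  {ξ | ∃ φ : ℝ → Eucl n, IsSolOn g X φ (Set.Ici 0) ∧ φ 0 = ξ ∧
    ∀ t ∈ Set.Ici (0 : ℝ), h (φ t) = 0}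

/-- The set `X^b(g,h,∞)`. -/
def XBwdInf {n : ℕ} (X : Set (Eucl n)) (g : Eucl n → Eucl n) (h : Eucl n → ℝ) :
    Set (Eucl n) :=
  {ξ | ∃ φ : ℝ → Eucl n, IsSolOn g X φ (Set.Iic 0) ∧ φ 0 = ξ ∧
    ∀ t ∈ Set.Iic (0 : ℝ), h (φ t) = 0}

/-- `X^f(g,h) = ∪_{τ>0} X^f(g,h,τ)`. -/
def XFwdFin {n : ℕ} (X : Set (Eucl n)) (g : Eucl n → Eucl n) (h : Eucl n → ℝ) :
    Set (Eucl n) :=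
  ⋃ τ ∈ Set.Ioi (0 : ℝ), XFwd X g h τ

/-- `X^b(g,h) = ∪_{τ>0} X^b(g,h,τ)`. -/
def XBwdFin {n : ℕ} (X : Set (Eucl n)) (g : Eucl n → Eucl n) (h : Eucl n → ℝ) :
    Set (Eucl n) :=
  ⋃ τ ∈ Set.Ioi (0 : ℝ), XBwd X g h τ

/-- Weakly meagre functions on `[0,∞)`. -/
def WeaklyMeagre (y : ℝ → ℝ) : Prop :=
  ∀ I : ℕ → Set ℝ, (∀ k, (I k).Nonempty) → (∀ k, I k ⊆ Set.Ici 0) →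
    (∀ k, (I k).OrdConnected) → (Pairwise fun k l => Disjoint (I k) (I l)) →
    (∃ δ : ENNReal, 0 < δ ∧ ∀ k, δ ≤ volume (I k)) →
    Filter.Tendsto (fun k => sInf ((fun t => |y t|) '' I k)) Filter.atTop (nhds 0)

/-- Assumption (E0) : the origin is an equilibrium point of the switched system. -/
def AssumpE0 {n : ℕ} {Γ : Type*} (f : Eucl n × Γ → Eucl n) (domf : Set (Eucl n × Γ)) : Prop :=
  ∀ γ : Γ, ((0 : Eucl n), γ) ∈ domf → f (0, γ) = 0

/-- Assumption (U) : uniqueness of the solution of the IVP `ẋ = f_γ(x)`, `x(0)=0`. -/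
def AssumpU {n : ℕ} {Γ : Type*} (f : Eucl n × Γ → Eucl n) (domf : Set (Eucl n × Γ)) : Prop :=
  ∀ γ : Γ, ((0 : Eucl n), γ) ∈ domf →
    ∀ I : Set ℝ, I.OrdConnected → (0 : ℝ) ∈ I →
    ∀ φ ψ : ℝ → Eucl n,
      IsSolOn (fun ξ => f (ξ, γ)) {ξ | (ξ, γ) ∈ domf} φ I →
      IsSolOn (fun ξ => f (ξ, γ)) {ξ | (ξ, γ) ∈ domf} ψ I →
      φ 0 = 0 → ψ 0 = 0 → ∀ t ∈ I, φ t = ψ t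

/-- The set `E_γ` of equilibrium points of `f_γ`. -/
def Egamma {n : ℕ} {Γ : Type*} (f : Eucl n × Γ → Eucl n) (domf : Set (Eucl n × Γ)) (γ : Γ) :
    Set (Eucl n) :=
  {ξ | (ξ, γ) ∈ domf ∧ f (ξ, γ) = 0}

/-- Discrete subsets of `ℝⁿ`. -/
def IsDiscreteSet {n : ℕ} (S : Set (Eucl n)) : Prop :=
  ∀ ξ ∈ S, ∃ ε > (0 : ℝ), S ∩ Metric.ball ξ ε = {ξ}

/-- Class-K functions (on `[0,∞)`). -/
structure ClassK (α : ℝ → ℝ) : Prop where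
  cont : ContinuousOn α (Set.Ici 0)
  mono : StrictMonoOn α (Set.Ici 0)
  zero : α 0 = 0

/-- Class-K∞ functions. -/
structure ClassKInf (α : ℝ → ℝ) extends ClassK α : Prop where
  unbounded : Filter.Tendsto α Filter.atTop Filter.atTop

/-- Local uniform stability of a family of forward complete trajectories. -/
def FamilyLUS {n : ℕ} {Γ : Type*} (T : Set ((ℝ → Eucl n) × (ℝ → Γ))) : Prop :=
  ∃ r > (0 : ℝ), ∃ α : ℝ → ℝ, ClassK α ∧
    ∀ xs ∈ T, ∀ t₀ : ℝ, 0 ≤ t₀ → ‖xs.1 t₀‖ ≤ r → ∀ t : ℝ, t₀ ≤ t → ‖xs.1 t‖ ≤ α ‖xs.1 t₀‖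

/-- Global uniform stability. -/
def FamilyGUS {n : ℕ} {Γ : Type*} (T : Set ((ℝ → Eucl n) × (ℝ → Γ))) : Prop :=
  ∃ α : ℝ → ℝ, ClassKInf α ∧
    ∀ xs ∈ T, ∀ t₀ : ℝ, 0 ≤ t₀ → ∀ t : ℝ, t₀ ≤ t → ‖xs.1 t‖ ≤ α ‖xs.1 t₀‖

/-- Local asymptotic stability. -/
def FamilyLAS {n : ℕ} {Γ : Type*} (T : Set ((ℝ → Eucl n) × (ℝ → Γ))) : Prop :=
  FamilyLUS T ∧ ∃ η > (0 : ℝ), ∀ xs ∈ T, ‖xs.1 0‖ < η →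
    Filter.Tendsto xs.1 Filter.atTop (nhds 0)

/-- Global asymptotic stability. -/
def FamilyGAS {n : ℕ} {Γ : Type*} (T : Set ((ℝ → Eucl n) × (ℝ → Γ))) : Prop :=
  FamilyGUS T ∧ ∀ xs ∈ T, Filter.Tendsto xs.1 Filter.atTop (nhds 0)

/-- A weak Lyapunov pair `(V,W)` for the family `T`. -/
structure WeakLyapunovPair {n : ℕ} {Γ : Type*} [TopologicalSpace Γ]
    (f : Eucl n × Γ → Eucl n) (domf : Set (Eucl n × Γ)) (V : Eucl n × Γ → ℝ)
    (domV : Set (Eucl n × Γ)) (W : Eucl n × Γ → ℝ)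
    (T : Set ((ℝ → Eucl n) × (ℝ → Γ))) : Prop where
  classV : ClassVFun V domV domf
  zeroMem : (0 : Eucl n) ∈ Oset domV
  bounds : ∃ α₁ α₂ : ℝ → ℝ, ClassK α₁ ∧ ClassK α₂ ∧
    ∀ γ : Γ, ∀ ξ ∈ Ogamma domV domf γ, α₁ ‖ξ‖ ≤ V (ξ, γ) ∧ V (ξ, γ) ≤ α₂ ‖ξ‖
  wineq : Wineq f V W domV domf
  decreasing : ∀ xs ∈ T, ∀ a b : ℝ, 0 ≤ a → a ≤ b →
    (∀ t ∈ Set.Icc a b, xs.1 t ∈ Oset domV) →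
    AntitoneOn (fun t => V (xs.1 t, xs.2 t)) (Set.Icc a b)

/-- An F-weak Lyapunov pair `(V,W)` for the family `T`. -/
structure FWeakLyapunovPair {n : ℕ} {Γ : Type*} [TopologicalSpace Γ]
    (f : Eucl n × Γ → Eucl n) (domf : Set (Eucl n × Γ)) (V : Eucl n × Γ → ℝ)
    (domV : Set (Eucl n × Γ)) (W : Eucl n × Γ → ℝ)
    (T : Set ((ℝ → Eucl n) × (ℝ → Γ))) : Prop where
  classV : ClassVFun V domV domf
  zeroMem : (0 : Eucl n) ∈ Oset domV
  bounds : ∃ α₁ α₂ : ℝ → ℝ, ClassK α₁ ∧ ClassK α₂ ∧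
    ∀ γ : Γ, ∀ ξ ∈ Ogamma domV domf γ, α₁ ‖ξ‖ ≤ V (ξ, γ) ∧ V (ξ, γ) ≤ α₂ ‖ξ‖
  wineq : Wineq f V W domV domf
  decreasing : ∀ xs ∈ T, ∀ a b : ℝ, 0 ≤ a → a ≤ b →
    (∀ t ∈ Set.Icc a b, xs.1 t ∈ Oset domV) →
    ∀ γ : Γ, AntitoneOn (fun t => V (xs.1 t, γ)) (Set.Icc a b ∩ {t | xs.2 t = γ})

/-- `V` is radially unbounded : the class-K bounds may be chosen of class K∞. -/
def RadiallyUnbounded {n : ℕ} {Γ : Type*} (V : Eucl n × Γ → ℝ)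
    (domV domf : Set (Eucl n × Γ)) : Prop :=
  ∃ α₁ α₂ : ℝ → ℝ, ClassKInf α₁ ∧ ClassKInf α₂ ∧
    ∀ γ : Γ, ∀ ξ ∈ Ogamma domV domf γ, α₁ ‖ξ‖ ≤ V (ξ, γ) ∧ V (ξ, γ) ≤ α₂ ‖ξ‖

/-- Simple cycle `{γ_i}_{i=1}^m` of the set-valued map `H`. -/
def IsSimpleCycle {Γ : Type*} (H : Γ → Set Γ) (m : ℕ) (γs : ℕ → Γ) : Prop :=
  3 ≤ m ∧ γs 1 = γs m ∧ (∀ i, 1 ≤ i → i < m → γs (i + 1) ∈ H (γs i)) ∧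
  ∀ i j, 1 ≤ i → i < j → j ≤ m → γs i = γs j → i = 1 ∧ j = m

/-- A family of forward complete trajectories of the switched system. -/
def ForwardCompleteFamily {n : ℕ} {Γ : Type*} [TopologicalSpace Γ]
    (f : Eucl n × Γ → Eucl n) (domf : Set (Eucl n × Γ))
    (T : Set ((ℝ → Eucl n) × (ℝ → Γ))) : Prop :=
  ∀ xs ∈ T, ∃ I : Set ℝ, Set.Ici (0 : ℝ) ⊆ I ∧ IsTrajectory f domf xs.1 xs.2 I

/-- Condition (a) : `O_γ^f(f_γ,W_γ,∞) ∩ O_γ^b(f_γ,W_γ,∞) ⊆ {0}` for every `γ`. -/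
def CondA {n : ℕ} {Γ : Type*} (f : Eucl n × Γ → Eucl n)
    (domf domV : Set (Eucl n × Γ)) (W : Eucl n × Γ → ℝ) : Prop :=
  ∀ γ : Γ, XFwdInf (Ogamma domV domf γ) (fun ξ => f (ξ, γ)) (fun ξ => W (ξ, γ)) ∩
    XBwdInf (Ogamma domV domf γ) (fun ξ => f (ξ, γ)) (fun ξ => W (ξ, γ)) ⊆ {0}

/-- Condition (b) : `O_γ^b(f_γ,W_γ) ∩ O_{γ'}^f(f_{γ'},W_{γ'}) ⊆ {0}` for `γ ≠ γ'`. -/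
def CondB {n : ℕ} {Γ : Type*} (f : Eucl n × Γ → Eucl n)
    (domf domV : Set (Eucl n × Γ)) (W : Eucl n × Γ → ℝ) : Prop :=
  ∀ γ γ' : Γ, γ ≠ γ' →
    XBwdFin (Ogamma domV domf γ) (fun ξ => f (ξ, γ)) (fun ξ => W (ξ, γ)) ∩
    XFwdFin (Ogamma domV domf γ') (fun ξ => f (ξ, γ')) (fun ξ => W (ξ, γ')) ⊆ {0}

/-- Condition (b') : the variant of (b) involving the level sets of `V`. -/
def CondB' {n : ℕ} {Γ : Type*} (f : Eucl n × Γ → Eucl n) (V : Eucl n × Γ → ℝ)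
    (domf domV : Set (Eucl n × Γ)) (W : Eucl n × Γ → ℝ) : Prop :=
  ∀ γ γ' : Γ, γ ≠ γ' → ∀ c : ℝ,
    XBwdFin (Ogamma domV domf γ) (fun ξ => f (ξ, γ)) (fun ξ => W (ξ, γ)) ∩
    XFwdFin (Ogamma domV domf γ') (fun ξ => f (ξ, γ')) (fun ξ => W (ξ, γ')) ∩
    {ξ : Eucl n | V (ξ, γ) = c} ∩ {ξ : Eucl n | V (ξ, γ') = c} ⊆ {0}

/-- Condition (i) of the cycle theorems :
either all the forward infinite-horizon sets, or all the backward ones, reduce to `{0}`. -/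
def CondI {n : ℕ} {Γ : Type*} (f : Eucl n × Γ → Eucl n)
    (domf domV : Set (Eucl n × Γ)) (W : Eucl n × Γ → ℝ) : Prop :=
  (∀ γ : Γ, XFwdInf (Ogamma domV domf γ) (fun ξ => f (ξ, γ)) (fun ξ => W (ξ, γ)) ⊆ {0}) ∨
  (∀ γ : Γ, XBwdInf (Ogamma domV domf γ) (fun ξ => f (ξ, γ)) (fun ξ => W (ξ, γ)) ⊆ {0})

/-- Condition (ii) on simple cycles of `H`. -/
def CondCycle {n : ℕ} {Γ : Type*} (f : Eucl n × Γ → Eucl n)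
    (domf domV : Set (Eucl n × Γ)) (W : Eucl n × Γ → ℝ) (H : Γ → Set Γ) : Prop :=
  ∀ m : ℕ, ∀ γs : ℕ → Γ, IsSimpleCycle H m γs →
    ∃ j : ℕ, 1 ≤ j ∧ j < m ∧
      XBwdFin (Ogamma domV domf (γs j)) (fun ξ => f (ξ, γs j)) (fun ξ => W (ξ, γs j)) ∩
      XFwdFin (Ogamma domV domf (γs (j + 1))) (fun ξ => f (ξ, γs (j + 1)))
        (fun ξ => W (ξ, γs (j + 1))) ⊆ {0}

/-- Condition (iii) on simple cycles of `H`, involving the level sets of `V`. -/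
def CondCycle' {n : ℕ} {Γ : Type*} (f : Eucl n × Γ → Eucl n) (V : Eucl n × Γ → ℝ)
    (domf domV : Set (Eucl n × Γ)) (W : Eucl n × Γ → ℝ) (H : Γ → Set Γ) : Prop :=
  ∀ c : ℝ, ∀ m : ℕ, ∀ γs : ℕ → Γ, IsSimpleCycle H m γs →
    ∃ j : ℕ, 1 ≤ j ∧ j < m ∧
      XBwdFin (Ogamma domV domf (γs j)) (fun ξ => f (ξ, γs j)) (fun ξ => W (ξ, γs j)) ∩
      XFwdFin (Ogamma domV domf (γs (j + 1))) (fun ξ => f (ξ, γs (j + 1)))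
        (fun ξ => W (ξ, γs (j + 1))) ∩
      {ξ : Eucl n | V (ξ, γs j) = c} ∩ {ξ : Eucl n | V (ξ, γs (j + 1)) = c} ⊆ {0}

/-- For every `γ`, `O_γ^b(f_γ,W_γ) = E_γ ∩ O_γ` or `O_γ^f(f_γ,W_γ) = E_γ ∩ O_γ`. -/
def CondEquilObs {n : ℕ} {Γ : Type*} (f : Eucl n × Γ → Eucl n)
    (domf domV : Set (Eucl n × Γ)) (W : Eucl n × Γ → ℝ) : Prop :=
  ∀ γ : Γ,
    XBwdFin (Ogamma domV domf γ) (fun ξ => f (ξ, γ)) (fun ξ => W (ξ, γ)) =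
      Egamma f domf γ ∩ Ogamma domV domf γ ∨
    XFwdFin (Ogamma domV domf γ) (fun ξ => f (ξ, γ)) (fun ξ => W (ξ, γ)) =
      Egamma f domf γ ∩ Ogamma domV domf γ

end

noncomputable section

lemma jump_spec {Γ : Type*} [MetricSpace Γ] [Finite Γ] {σ : ℝ → Γ} (hσ : IsSwitchingSignal σ)
    (t : ℝ) : ∃ γ : Γ, ∃ ε > (0:ℝ), (∀ s ∈ Ioo (t - ε) t, σ s = γ) ∧
      (t ∈ JumpTimes σ → γ ≠ σ t) ∧ Tendsto σ (𝓝[<] t) (𝓝 γ) := by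
  obtain ⟨ε, hε, h⟩ := hσ.leftConst t
  have hconst : ∀ s ∈ Ioo (t - ε) t, σ s = σ (t - ε / 2) := fun s hs =>
    h s hs _ ⟨by linarith, by linarith⟩
  have hev : ∀ᶠ s in 𝓝[<] t, σ s = σ (t - ε / 2) := by
    filter_upwards [Ioo_mem_nhdsLT (show t - ε < t by linarith)] with s hs using hconst s hs
  refine ⟨σ (t - ε/2), ε, hε, hconst, ?_, tendsto_const_nhds.congr' (hev.mono fun s hs => hs.symm)⟩
  intro hj heq
  apply hj
  obtain ⟨ε', hε', h'⟩ := hσ.rightConst t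
  have : ∀ᶠ s in 𝓝 t, σ s = σ t := by
    filter_upwards [Ioo_mem_nhds (show t - ε < t by linarith) (show t < t + ε' by linarith)] with s hs
    rcases lt_or_ge s t with h1 | h1
    · rw [hconst s ⟨hs.1, h1⟩, heq]
    · exact h' s ⟨h1, hs.2⟩
  exact tendsto_const_nhds.congr' (this.mono fun s hs => hs.symm)

lemma const_of_no_jump {Γ : Type*} [MetricSpace Γ] [Finite Γ] {σ : ℝ → Γ} {S : Set ℝ}
    (hS : S.OrdConnected) (h : ∀ t ∈ S, t ∉ JumpTimes σ) {p q : ℝ} (hp : p ∈ S) (hq : q ∈ S) :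
    σ p = σ q := by
  have hc : ContinuousOn σ S := fun t ht => by
    have := h t ht
    simp only [JumpTimes, mem_ofPred_eq, not_not] at this
    exact this.continuousWithinAt
  exact hS.isPreconnected.constant hc hp hq

lemma const_Ico {Γ : Type*} [MetricSpace Γ] [Finite Γ] {σ : ℝ → Γ} (hσ : IsSwitchingSignal σ)
    {a b : ℝ} (h : ∀ t ∈ Ioo a b, t ∉ JumpTimes σ) : ∀ t ∈ Ico a b, σ t = σ a := by
  intro t ht
  obtain ⟨ε, hε, h'⟩ := hσ.rightConst a
  rcases eq_or_lt_of_le ht.1 with h1 | h1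
  · rw [← h1]
  have hm : a < min t (a + ε / 2) := lt_min h1 (by linarith)
  rw [← h' (min t (a + ε/2)) ⟨hm.le, by linarith [min_le_right t (a + ε/2)]⟩]
  exact const_of_no_jump ordConnected_Ioo h ⟨h1, ht.2⟩ ⟨hm, lt_of_le_of_lt (min_le_left _ _) ht.2⟩

lemma dwell_gap {Γ : Type*} [MetricSpace Γ] {σ : ℝ → Γ} {τ : ℝ} (hτ : 0 < τ)
    (h : σ ∈ SD Γ τ) {p q : ℝ} (hp : p ∈ JumpTimes σ) (hq : q ∈ JumpTimes σ) (hpq : p < q) :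
    τ ≤ q - p := by
  by_contra hlt
  push Not at hlt
  set e := (τ - (q - p)) / 4 with he
  have he0 : 0 < e := by rw [he]; linarith
  have h1 := h.2 (p - e) (q + e) (by linarith)
  have hfin : (JumpTimes σ ∩ Ioo (p - e) (q + e)).Finite :=
    (h.1.locFinite (p - e) (q + e)).subset (inter_subset_inter_right _ Ioo_subset_Icc_self)
  have h2 : ({p, q} : Set ℝ) ⊆ JumpTimes σ ∩ Ioo (p - e) (q + e) := by
    rintro y (rfl | rfl)
    · exact ⟨hp, by linarith, by linarith⟩
    · exact ⟨hq, by linarith, by linarith⟩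
  have h3 := ncard_le_ncard h2 hfin
  rw [ncard_pair hpq.ne] at h3
  have h4 : (2:ℝ) ≤ ((JumpTimes σ ∩ Ioo (p - e) (q + e)).ncard : ℝ) := by exact_mod_cast h3
  have h5 : (q + e - (p - e)) / τ < 1 := by
    rw [div_lt_one hτ]; linarith
  push_cast at h1
  linarith

/-- Every tail of a signal with unboundedly many jumps has a jump with a good edge. -/
lemma exists_good_jump {Γ : Type*} [MetricSpace Γ] [Finite Γ] {σ : ℝ → Γ}
    (hσ : IsSwitchingSignal σ) (H : Γ → Set Γ) (hH : σ ∈ SH H)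
    (hinf : ∀ t : ℝ, ∃ s ∈ JumpTimes σ, t < s) (Good : Γ → Γ → Prop)
    (hcyc : ∀ m γs, IsSimpleCycle H m γs → ∃ j, 1 ≤ j ∧ j < m ∧ Good (γs j) (γs (j+1)))
    (T0 : ℝ) : ∃ t ∈ JumpTimes σ, T0 < t ∧ ∃ γ, Good γ (σ t) ∧ ∃ ε > (0:ℝ),
      ∀ s ∈ Ioo (t - ε) t, σ s = γ := by
  have hnext : ∀ t : ℝ, ∃ s ∈ JumpTimes σ, t < s ∧ ∀ u ∈ Ioo t s, u ∉ JumpTimes σ := by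
    intro t
    obtain ⟨s0, hs0, hts0⟩ := hinf t
    have hfin : (JumpTimes σ ∩ Ioc t s0).Finite :=
      (hσ.locFinite t s0).subset (inter_subset_inter_right _ Ioc_subset_Icc_self)
    obtain ⟨s, hs, hmin⟩ := hfin.exists_minimal ⟨s0, hs0, hts0, le_rfl⟩
    refine ⟨s, hs.1, hs.2.1, fun u hu huJ => ?_⟩
    have := hmin (y := u) ⟨huJ, hu.1, hu.2.le.trans hs.2.2⟩ hu.2.le
    linarith [hu.2]
  choose nx hnJ hnlt hnno using hnext
  let t : ℕ → ℝ := fun k => Nat.rec (nx T0) (fun _ r => nx r) k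
  have ht1 : ∀ k, t (k+1) = nx (t k) := fun k => rfl
  have htJ : ∀ k, t k ∈ JumpTimes σ := by
    intro k; cases k with
    | zero => exact hnJ T0
    | succ k => exact hnJ _
  have htlt : ∀ k, T0 < t k := by
    intro k; induction k with
    | zero => exact hnlt T0
    | succ k ih => exact ih.trans (hnlt _)
  have hconst : ∀ k, ∀ s ∈ Ico (t k) (t (k+1)), σ s = σ (t k) := fun k =>
    const_Ico hσ (hnno (t k))
  have hedge : ∀ k, σ (t k) ≠ σ (t (k+1)) ∧ σ (t (k+1)) ∈ H (σ (t k)) := by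
    intro k
    obtain ⟨γ, ε, hε, h1, h2, h3⟩ := jump_spec hσ (t (k+1))
    have hlt : t k < t (k+1) := hnlt _
    have hm : max (t k) (t (k+1) - ε/2) < t (k+1) := max_lt hlt (by linarith)
    have : γ = σ (t k) := by
      rw [← hconst k _ ⟨le_max_left _ _, hm⟩]
      exact (h1 _ ⟨by linarith [le_max_right (t k) (t (k+1) - ε/2)], hm⟩).symm
    subst this
    exact ⟨h2 (htJ (k+1)), hH (t (k+1)) (htJ (k+1)) _ h3⟩
  have hrep : ∃ d, ∃ i, 0 < d ∧ σ (t i) = σ (t (i + d)) := by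
    obtain ⟨i, j, hij, h⟩ := Finite.exists_ne_map_eq_of_infinite (fun k => σ (t k))
    rcases lt_or_gt_of_ne hij with h1 | h1
    · exact ⟨j - i, i, by omega, by rw [Nat.add_sub_cancel' h1.le]; exact h⟩
    · exact ⟨i - j, j, by omega, by rw [Nat.add_sub_cancel' h1.le]; exact h.symm⟩
  classical
  obtain ⟨i, hd, hi⟩ := Nat.find_spec hrep
  have hmin : ∀ d, 0 < d → ∀ i', σ (t i') = σ (t (i' + d)) → Nat.find hrep ≤ d :=
    fun d hd i' h => Nat.find_min' hrep ⟨i', hd, h⟩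
  generalize Nat.find hrep = d at hd hi hmin
  have hd1 : d ≠ 1 := by
    rintro rfl
    exact (hedge i).1 hi
  obtain ⟨j, hj1, hjm, hg⟩ := hcyc (d + 1) (fun l => σ (t (i + l - 1))) (by
    refine ⟨by omega, ?_, ?_, ?_⟩
    · simpa using hi
    · intro l hl _
      have := (hedge (i + l - 1)).2
      rwa [show i + l - 1 + 1 = i + (l + 1) - 1 by omega] at this
    · intro a b ha hab hb h
      have := hmin (b - a) (by omega) (i + a - 1) (by
        rw [show i + a - 1 + (b - a) = i + b - 1 by omega]; exact h)
      omega)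
  have e : i + (j + 1) - 1 = (i + j - 1) + 1 := by omega
  simp only [e] at hg
  refine ⟨t (i + j - 1 + 1), htJ (i + j - 1 + 1), htlt (i + j - 1 + 1), _, hg, t (i+j-1+1) - t (i+j-1), sub_pos.2 (hnlt _), ?_⟩
  intro s hs
  exact hconst _ s ⟨by linarith [hs.1], hs.2⟩

/-- Integral estimate along a trajectory. -/
lemma traj_est {n : ℕ} {Γ : Type*} [TopologicalSpace Γ] {f : Eucl n × Γ → Eucl n}
    {domf : Set (Eucl n × Γ)} {x : ℝ → Eucl n} {σ : ℝ → Γ} {I : Set ℝ}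
    (h : IsTrajectory f domf x σ I) {p q : ℝ} (hp : p ∈ I) (hq : q ∈ I) (c0 : Eucl n) (ε : ℝ)
    (hb : ∀ w ∈ Ioo (min p q) (max p q), ‖f (x w, σ w) - c0‖ ≤ ε) :
    ‖x q - x p - (q - p) • c0‖ ≤ ε * |q - p| := by
  obtain ⟨hi, he⟩ := h.intg p hp q hq
  have : x q - x p - (q - p) • c0 = ∫ s in p..q, (f (x s, σ s) - c0) := by
    rw [intervalIntegral.integral_sub hi (by simp), he]
    simp
  rw [this]
  apply intervalIntegral.norm_integral_le_of_norm_le_const_ae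
  have hne : ∀ᵐ w : ℝ, w ≠ max p q := by
    simp [ae_iff]
  filter_upwards [hne] with w hw hw2
  exact hb w ⟨hw2.1, lt_of_le_of_ne hw2.2 hw⟩

end

noncomputable section

lemma traj_lip {n : ℕ} {Γ : Type*} [MetricSpace Γ] [Finite Γ] {f : Eucl n × Γ → Eucl n}
    {domf : Set (Eucl n × Γ)} (hdomf : IsClosed domf) (hf : ContinuousOn f domf)
    {x : ℝ → Eucl n} {σ : ℝ → Γ} {I : Set ℝ}
    (h : IsTrajectory f domf x σ I) (hI : Ici 0 ⊆ I) {B : Set (Eucl n)} (hB : IsCompact B)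
    (hxB : ∀ t, 0 ≤ t → x t ∈ B) :
    ∃ M : ℝ, 0 ≤ M ∧ ∀ p q, 0 ≤ p → 0 ≤ q → ‖x q - x p‖ ≤ M * |q - p| := by
  have hK : IsCompact ((B ×ˢ (univ : Set Γ)) ∩ domf) :=
    (hB.prod finite_univ.isCompact).inter_right hdomf
  obtain ⟨M, hM⟩ := hK.exists_bound_of_continuousOn (hf.mono inter_subset_right)
  refine ⟨max M 0, le_max_right _ _, fun p q hp hq => ?_⟩
  have := traj_est h (hI hp) (hI hq) 0 (max M 0) (fun w hw => by
    have hw0 : 0 ≤ w := (le_min hp hq).trans hw.1.le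
    rw [sub_zero]
    exact (hM _ ⟨⟨hxB w hw0, mem_univ _⟩, h.mem w (hI hw0)⟩).trans (le_max_left _ _))
  simpa using this

lemma lim_sol {n : ℕ} {Γ : Type*} [MetricSpace Γ] [Finite Γ] {f : Eucl n × Γ → Eucl n}
    {domf : Set (Eucl n × Γ)} (hdomf : IsClosed domf) (hf : ContinuousOn f domf)
    {x : ℝ → Eucl n} {σ : ℝ → Γ} {I : Set ℝ}
    (h : IsTrajectory f domf x σ I) (hI : Ici 0 ⊆ I) {B : Set (Eucl n)} (hB : IsCompact B)
    (hxB : ∀ t, 0 ≤ t → x t ∈ B) {l : Filter ℝ} [l.NeBot] (hl : l ≤ atTop) {φ : ℝ → Eucl n}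
    (hφ : ∀ u, Tendsto (fun s => x (s + u)) l (𝓝 (φ u))) {γ : Γ} {a b : ℝ} (hab : a < b)
    (hσ : ∀ᶠ s in l, ∀ u ∈ Ioo a b, σ (s + u) = γ) :
    Continuous φ ∧ (∀ u ∈ Icc a b, φ u ∈ B ∧ (φ u, γ) ∈ domf) ∧
    ∀ u ∈ Icc a b, HasDerivWithinAt φ (f (φ u, γ)) (Icc a b) u := by
  obtain ⟨M, hM0, hM⟩ := traj_lip hdomf hf h hI hB hxB
  have hpos : ∀ u : ℝ, ∀ᶠ s in l, 0 ≤ s + u := fun u => by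
    filter_upwards [hl (eventually_ge_atTop (-u))] with s hs
    linarith
  have hlip : ∀ p q, ‖φ q - φ p‖ ≤ M * |q - p| := by
    intro p q
    refine le_of_tendsto ((hφ q).sub (hφ p)).norm ?_
    filter_upwards [hpos p, hpos q] with s h1 h2
    simpa using hM _ _ h1 h2
  have hcont : Continuous φ := by
    have : LipschitzWith (Real.toNNReal M) φ := LipschitzWith.of_dist_le_mul fun p q => by
      rw [dist_eq_norm, Real.dist_eq, Real.coe_toNNReal M hM0]
      exact hlip q p
    exact this.continuous
  have hφB : ∀ u, φ u ∈ B := fun u => hB.isClosed.mem_of_tendsto (hφ u)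
    ((hpos u).mono fun s hs => hxB _ hs)
  have hdom : ∀ u ∈ Icc a b, (φ u, γ) ∈ domf := by
    have hcl : IsClosed {u | (φ u, γ) ∈ domf} :=
      hdomf.preimage (hcont.prodMk continuous_const)
    have hsub : Ioo a b ⊆ {u | (φ u, γ) ∈ domf} := by
      intro u hu
      refine hdomf.mem_of_tendsto ((hφ u).prodMk_nhds (tendsto_const_nhds (x := γ))) ?_
      filter_upwards [hpos u, hσ] with s h1 h2
      rw [← h2 u hu]
      exact h.mem _ (hI h1)
    rw [← closure_Ioo hab.ne]
    exact closure_minimal hsub hcl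
  refine ⟨hcont, fun u hu => ⟨hφB u, hdom u hu⟩, fun u hu => ?_⟩
  rw [hasDerivWithinAt_iff_isLittleO, Asymptotics.isLittleO_iff]
  intro ε hε
  have hc : ContinuousOn (fun ξ => f (ξ, γ)) {ξ | (ξ, γ) ∈ domf} :=
    hf.comp (by fun_prop) (fun ξ hξ => hξ)
  obtain ⟨η, hη, hc'⟩ := Metric.continuousOn_iff.1 hc (φ u) (hdom u hu) ε hε
  have hδ : 0 < η / (2 * (M + 1)) := by positivity
  filter_upwards [self_mem_nhdsWithin, mem_nhdsWithin_of_mem_nhds (Metric.ball_mem_nhds u hδ)]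
    with v hv hvu
  rw [Metric.mem_ball, Real.dist_eq, lt_div_iff₀ (by positivity)] at hvu
  have hlim : Tendsto (fun s => ‖x (s + v) - x (s + u) - (v - u) • f (φ u, γ)‖) l
      (𝓝 ‖φ v - φ u - (v - u) • f (φ u, γ)‖) := (((hφ v).sub (hφ u)).sub_const _).norm
  refine le_of_tendsto hlim ?_
  have hnear : ∀ᶠ s in l, dist (x (s + u)) (φ u) < η / 2 :=
    Metric.tendsto_nhds.1 (hφ u) _ (by positivity)
  filter_upwards [hpos u, hpos v, hpos a, hσ, hnear] with s h1 h2 h3 h4 h5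
  have := traj_est h (hI h1) (hI h2) (f (φ u, γ)) ε (by
    intro w hw
    have hw0 : 0 ≤ w := (le_min h1 h2).trans hw.1.le
    have hw1 : s + a ≤ min (s+u) (s+v) := le_min (by linarith [hu.1]) (by linarith [hv.1])
    have hw2 : max (s+u) (s+v) ≤ s + b := max_le (by linarith [hu.2]) (by linarith [hv.2])
    have hsw : σ w = γ := by
      have := h4 (w - s) ⟨by linarith [hw.1], by linarith [hw.2]⟩
      rwa [add_sub_cancel] at this
    have hwd := h.mem w (hI hw0)
    rw [hsw] at hwd ⊢
    rw [← dist_eq_norm]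
    refine (hc' (x w) hwd ?_).le
    have hd := hM (s+u) w h1 hw0
    have hwu : |w - (s+u)| ≤ |v - u| := by
      have := abs_sub_left_of_mem_uIcc (a := s+u) (b := s+v) (c := w)
        ⟨hw.1.le, hw.2.le⟩
      simpa [abs_sub_comm] using this
    calc dist (x w) (φ u) ≤ dist (x w) (x (s+u)) + dist (x (s+u)) (φ u) := dist_triangle _ _ _
      _ < η := by
        rw [dist_eq_norm (x w)]
        have : M * |w - (s+u)| ≤ M * |v-u| := mul_le_mul_of_nonneg_left hwu hM0
        nlinarith [abs_nonneg (v-u)])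
  simpa using this

/-- Everything about a limit solution in mode `γ`. -/
lemma lim_sol_full {n : ℕ} {Γ : Type*} [MetricSpace Γ] [Finite Γ] {f : Eucl n × Γ → Eucl n}
    {domf : Set (Eucl n × Γ)} (hdomf : IsClosed domf) (hf : ContinuousOn f domf)
    {x : ℝ → Eucl n} {σ : ℝ → Γ} {I : Set ℝ}
    (h : IsTrajectory f domf x σ I) (hI : Ici 0 ⊆ I) {B : Set (Eucl n)} (hB : IsCompact B)
    (hxB : ∀ t, 0 ≤ t → x t ∈ B)
    {V W : Eucl n × Γ → ℝ} {domV : Set (Eucl n × Γ)} (hBO : B ⊆ Oset domV)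
    (hV : ClassVFun V domV domf) (hW : Wineq f V W domV domf)
    {l : Filter ℝ} [l.NeBot] (hl : l ≤ atTop) {φ : ℝ → Eucl n}
    (hφ : ∀ u, Tendsto (fun s => x (s + u)) l (𝓝 (φ u))) {γ : Γ} {c : ℝ}
    (hc : Tendsto (fun t => V (x t, γ)) (atTop ⊓ 𝓟 {t | σ t = γ}) (𝓝 c))
    {a b : ℝ} (hab : a < b)
    (hσ : ∀ᶠ s in l, ∀ u ∈ Ioo a b, σ (s + u) = γ) :
    IsSolOn (fun ξ => f (ξ, γ)) (Ogamma domV domf γ) φ (Icc a b) ∧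
    ∀ u ∈ Icc a b, W (φ u, γ) = 0 ∧ V (φ u, γ) = c := by
  obtain ⟨hcont, hmem, hder⟩ := lim_sol hdomf hf h hI hB hxB hl hφ hab hσ
  have hO : ∀ u ∈ Icc a b, φ u ∈ Ogamma domV domf γ := fun u hu =>
    ⟨hBO (hmem u hu).1, (hmem u hu).2⟩
  have hVc : ContinuousOn (fun u => V (φ u, γ)) (Icc a b) := fun u hu =>
    ((hV.diff γ _ (hO u hu)).continuousAt.comp (f := φ) hcont.continuousAt).continuousWithinAt
  have hVo : ∀ u ∈ Ioo a b, V (φ u, γ) = c := by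
    intro u hu
    have h1 : Tendsto (fun s => V (x (s + u), γ)) l (𝓝 (V (φ u, γ))) :=
      (hV.diff γ _ (hO u (Ioo_subset_Icc_self hu))).continuousAt.tendsto.comp (hφ u)
    have h2 : Tendsto (fun s => s + u) l (atTop ⊓ 𝓟 {t | σ t = γ}) := by
      refine tendsto_inf.2 ⟨(tendsto_atTop_add_const_right _ u tendsto_id).mono_left hl, ?_⟩
      rw [tendsto_principal]
      filter_upwards [hσ] with s hs using hs u hu
    exact tendsto_nhds_unique h1 (hc.comp h2)
  have hVe : ∀ u ∈ Icc a b, V (φ u, γ) = c := by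
    have : EqOn (fun u => V (φ u, γ)) (fun _ => c) (Icc a b) :=
      EqOn.of_subset_closure (s := Ioo a b) (fun u hu => hVo u hu) hVc continuousOn_const
        Ioo_subset_Icc_self (by rw [closure_Ioo hab.ne])
    exact this
  refine ⟨⟨hcont.continuousOn, hO, ?_⟩, fun u hu => ⟨?_, hVe u hu⟩⟩
  · have hfc : ContinuousOn (fun u => f (φ u, γ)) (Icc a b) :=
      hf.comp (hcont.prodMk continuous_const).continuousOn fun u hu => (hmem u hu).2
    intro t₀ ht₀ t ht
    have hsub : uIcc t₀ t ⊆ Icc a b := ordConnected_Icc.uIcc_subset ht₀ ht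
    have hintg : IntervalIntegrable (fun s => f (φ s, γ)) volume t₀ t :=
      (hfc.mono hsub).intervalIntegrable
    refine ⟨hintg, ?_⟩
    have := intervalIntegral.integral_eq_sub_of_hasDeriv_right (f := φ)
      (f' := fun s => f (φ s, γ)) (a := t₀) (b := t) hcont.continuousOn
      (fun s hs => by
        have h1 : a ≤ min t₀ t := le_min ht₀.1 ht.1
        have h2 : max t₀ t ≤ b := max_le ht₀.2 ht.2
        have hd := hder s ⟨by linarith [hs.1], by linarith [hs.2]⟩
        exact (hd.hasDerivAt (Icc_mem_nhds (by linarith [hs.1])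
          (by linarith [hs.2]))).hasDerivWithinAt) hintg
    simp only [this]
    abel
  · have h1 := (hV.diff γ _ (hO u hu)).hasFDerivAt.comp_hasDerivWithinAt u (hder u hu)
    have h2 : HasDerivWithinAt (fun u => V (φ u, γ)) 0 (Icc a b) u :=
      (hasDerivWithinAt_const u (Icc a b) c).congr (fun v hv => hVe v hv) (hVe u hu)
    have h3 := (uniqueDiffOn_Icc hab u hu).eq_deriv _ h1 h2
    have h4 := hW γ _ (hO u hu)
    rw [h3] at h4
    linarith [h4.1, h4.2]

end

noncomputable section

lemma ultra_lim {n : ℕ} {x : ℝ → Eucl n} {B : Set (Eucl n)} (hB : IsCompact B)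
    (hxB : ∀ t, 0 ≤ t → x t ∈ B) (U : Ultrafilter ℝ) (hU : (U : Filter ℝ) ≤ atTop) :
    ∃ φ : ℝ → Eucl n, ∀ u, Tendsto (fun s => x (s + u)) U (𝓝 (φ u)) := by
  have : ∀ u : ℝ, ∃ y, Tendsto (fun s => x (s + u)) U (𝓝 y) := by
    intro u
    have hm : ((U.map fun s => x (s + u) : Ultrafilter (Eucl n)) : Filter (Eucl n)) ≤ 𝓟 B := by
      rw [le_principal_iff]
      have : ∀ᶠ s in (U : Filter ℝ), x (s + u) ∈ B := by
        filter_upwards [hU (eventually_ge_atTop (-u))] with s hs using hxB _ (by linarith)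
      exact this
    obtain ⟨y, _, hy⟩ := hB.ultrafilter_le_nhds _ hm
    exact ⟨y, hy⟩
  choose φ hφ using this
  exact ⟨φ, hφ⟩

lemma attract {n : ℕ} {Γ : Type*} [MetricSpace Γ] [Finite Γ] {f : Eucl n × Γ → Eucl n}
    {domf : Set (Eucl n × Γ)} (hdomf : IsClosed domf) (hf : ContinuousOn f domf)
    {x : ℝ → Eucl n} {σ : ℝ → Γ} {I : Set ℝ}
    (h : IsTrajectory f domf x σ I) (hI : Ici 0 ⊆ I) {B : Set (Eucl n)} (hB : IsCompact B)
    (hxB : ∀ t, 0 ≤ t → x t ∈ B)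
    {V W : Eucl n × Γ → ℝ} {domV : Set (Eucl n × Γ)} (hBO : B ⊆ Oset domV)
    (hV : ClassVFun V domV domf) (hW : Wineq f V W domV domf)
    (H : Γ → Set Γ) (hσ : σ ∈ SDall Γ ∩ SH H) (c : Γ → ℝ)
    (hc : ∀ γ, Tendsto (fun t => V (x t, γ)) (atTop ⊓ 𝓟 {t | σ t = γ}) (𝓝 (c γ)))
    (hCI : CondI f domf domV W)
    (hcyc : ∀ m γs, IsSimpleCycle H m γs → ∃ j, 1 ≤ j ∧ j < m ∧
      XBwdFin (Ogamma domV domf (γs j)) (fun ξ => f (ξ, γs j)) (fun ξ => W (ξ, γs j)) ∩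
      XFwdFin (Ogamma domV domf (γs (j + 1))) (fun ξ => f (ξ, γs (j + 1)))
        (fun ξ => W (ξ, γs (j + 1))) ∩
      {ξ : Eucl n | V (ξ, γs j) = c (γs j)} ∩
      {ξ : Eucl n | V (ξ, γs (j + 1)) = c (γs (j + 1))} ⊆ {0})
    (hstab : ∀ ε > (0:ℝ), ∃ δ > (0:ℝ), ∀ t₀, 0 ≤ t₀ → ‖x t₀‖ < δ → ∀ t, t₀ ≤ t → ‖x t‖ < ε) :
    Tendsto x atTop (𝓝 0) := by
  suffices hs : ∃ U : Ultrafilter ℝ, (U : Filter ℝ) ≤ atTop ∧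
      Tendsto (fun s => x (s + 0)) U (𝓝 0) by
    obtain ⟨U, hU, hx⟩ := hs
    rw [Metric.tendsto_nhds]
    intro ε hε
    obtain ⟨δ, hδ, hd⟩ := hstab ε hε
    obtain ⟨t₀, ht₀, ht₀'⟩ := ((Metric.tendsto_nhds.1 hx δ hδ).and
      (hU (eventually_ge_atTop 0))).exists
    filter_upwards [eventually_ge_atTop t₀] with t ht
    simp only [add_zero, dist_zero_right] at ht₀ ⊢
    exact hd t₀ ht₀' ht₀ t ht
  by_cases hinf : ∀ t : ℝ, ∃ s ∈ JumpTimes σ, t < s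
  · -- infinitely many jumps
    obtain ⟨hSD, hSH⟩ := hσ
    simp only [SDall, mem_iUnion, exists_prop] at hSD
    obtain ⟨τ, hτ, hSD⟩ := hSD
    have hτ0 : (0:ℝ) < τ := hτ
    let Good : Γ → Γ → Prop := fun γ γ' =>
      XBwdFin (Ogamma domV domf γ) (fun ξ => f (ξ, γ)) (fun ξ => W (ξ, γ)) ∩
      XFwdFin (Ogamma domV domf γ') (fun ξ => f (ξ, γ')) (fun ξ => W (ξ, γ')) ∩
      {ξ : Eucl n | V (ξ, γ) = c γ} ∩ {ξ : Eucl n | V (ξ, γ') = c γ'} ⊆ {0}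
    have hgood := exists_good_jump h.signal H hSH hinf Good hcyc
    -- edge property at time t
    let P : Γ × Γ → ℝ → Prop := fun e t => Good e.1 e.2 ∧
      (∀ u ∈ Ioo (-τ) 0, σ (t + u) = e.1) ∧ ∀ u ∈ Ioo 0 τ, σ (t + u) = e.2
    have hfreq : ∃ᶠ t in atTop, ∃ e, P e t := by
      rw [frequently_atTop]
      intro T0
      obtain ⟨t, htJ, htT, γ, hg, ε, hε, hl⟩ := hgood T0
      refine ⟨t, htT.le, (γ, σ t), hg, ?_, ?_⟩
      · intro u hu
        have hnj : ∀ s ∈ Ioo (t - τ) t, s ∉ JumpTimes σ := fun s hs hJ => by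
          have := dwell_gap hτ0 hSD hJ htJ hs.2
          linarith [hs.1]
        have hm : max (t - τ/2) (t - ε/2) < t := max_lt (by linarith) (by linarith)
        rw [← hl (max (t - τ/2) (t - ε/2))
          ⟨by linarith [le_max_right (t - τ/2) (t - ε/2)], hm⟩]
        exact const_of_no_jump ordConnected_Ioo hnj
          ⟨by linarith [hu.1], by linarith [hu.2]⟩
          ⟨by linarith [le_max_left (t - τ/2) (t - ε/2)], hm⟩
      · intro u hu
        refine const_Ico h.signal (a := t) (b := t + τ) (fun s hs hJ => ?_) _
          ⟨by linarith [hu.1], by linarith [hu.2]⟩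
        have := dwell_gap hτ0 hSD htJ hJ hs.1
        linarith [hs.2]
    have hne : (atTop ⊓ 𝓟 {t | ∃ e, P e t} : Filter ℝ).NeBot :=
      frequently_mem_iff_neBot.1 hfreq
    let U : Ultrafilter ℝ := Ultrafilter.of (atTop ⊓ 𝓟 {t | ∃ e, P e t})
    have hUle : (U : Filter ℝ) ≤ atTop ⊓ 𝓟 {t | ∃ e, P e t} := Ultrafilter.of_le _
    have hU : (U : Filter ℝ) ≤ atTop := hUle.trans inf_le_left
    have hUP : ∀ᶠ t in (U : Filter ℝ), ∃ e, P e t :=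
      (hUle.trans inf_le_right) (mem_principal_self _)
    obtain ⟨e, he⟩ : ∃ e, ∀ᶠ t in (U : Filter ℝ), P e t := by
      have h1 : (⋃ e, {t | P e t}) ∈ U := by
        filter_upwards [hUP] with t ht
        simpa using ht
      rw [← sUnion_range] at h1
      obtain ⟨_, ⟨e, rfl⟩, he⟩ := (Ultrafilter.finite_sUnion_mem_iff (finite_range _)).1 h1
      exact ⟨e, he⟩
    obtain ⟨φ, hφ⟩ := ultra_lim hB hxB U hU
    refine ⟨U, hU, ?_⟩
    obtain ⟨hg, -⟩ := he.exists.choose_spec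
    have hb := lim_sol_full hdomf hf h hI hB hxB hBO hV hW hU hφ (hc e.1)
      (show -τ < 0 by linarith) (he.mono fun t ht => ht.2.1)
    have hf' := lim_sol_full hdomf hf h hI hB hxB hBO hV hW hU hφ (hc e.2)
      hτ0 (he.mono fun t ht => ht.2.2)
    have h0 : φ 0 = 0 := by
      refine hg ⟨⟨⟨?_, ?_⟩, ?_⟩, ?_⟩
      · simp only [XBwdFin, mem_iUnion]
        exact ⟨τ, hτ, φ, hb.1, rfl, fun t ht => (hb.2 t ht).1⟩
      · simp only [XFwdFin, mem_iUnion]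
        exact ⟨τ, hτ, φ, hf'.1, rfl, fun t ht => (hf'.2 t ht).1⟩
      · exact (hb.2 0 ⟨by linarith, le_rfl⟩).2
      · exact (hf'.2 0 ⟨le_rfl, hτ0.le⟩).2
    have := hφ 0
    rwa [h0] at this
  · -- finitely many jumps
    push Not at hinf
    obtain ⟨T0, hT0⟩ := hinf
    have hconst : ∀ t ∈ Ioi T0, σ t = σ (T0 + 1) := fun t ht =>
      const_of_no_jump ordConnected_Ioi (fun s hs hJ => absurd (hT0 s hJ) (not_le.2 hs)) ht
        (show T0 < T0 + 1 by linarith)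
    let U : Ultrafilter ℝ := Ultrafilter.of atTop
    have hU : (U : Filter ℝ) ≤ atTop := Ultrafilter.of_le _
    obtain ⟨φ, hφ⟩ := ultra_lim hB hxB U hU
    refine ⟨U, hU, ?_⟩
    generalize σ (T0 + 1) = γ at hconst
    have key : ∀ a b : ℝ, a < b → _ := fun a b hab =>
      lim_sol_full hdomf hf h hI hB hxB hBO hV hW hU hφ (hc γ) hab (by
        filter_upwards [hU (eventually_gt_atTop (T0 - a))] with s hs u hu
        exact hconst _ (show T0 < s + u by linarith [hu.1]))
    have hsol : ∀ J : Set ℝ,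
        IsSolOn (fun ξ => f (ξ, γ)) (Ogamma domV domf γ) φ J ∧ ∀ u ∈ J, W (φ u, γ) = 0 := by
      intro J
      have hk1 : ∀ u : ℝ, u ∈ Icc (u - 1) (u + 1) := fun u => ⟨by linarith, by linarith⟩
      refine ⟨⟨?_, ?_, ?_⟩, ?_⟩
      · intro u _
        exact (((key (u-1) (u+1) (by linarith)).1.1).continuousAt
          (Icc_mem_nhds (by linarith) (by linarith))).continuousWithinAt
      · intro u _
        exact (key (u-1) (u+1) (by linarith)).1.2.1 u (hk1 u)
      · intro t₀ _ t _
        have hlt : min t₀ t - 1 < max t₀ t := by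
          linarith [min_le_left t₀ t, le_max_left t₀ t]
        exact (key _ _ hlt).1.2.2 t₀ ⟨by linarith [min_le_left t₀ t], le_max_left _ _⟩
          t ⟨by linarith [min_le_right t₀ t], le_max_right _ _⟩
      · intro u _
        exact ((key (u-1) (u+1) (by linarith)).2 u (hk1 u)).1
    have h0 : φ 0 = 0 := by
      rcases hCI with hF | hb
      · exact hF γ ⟨φ, (hsol _).1, rfl, (hsol _).2⟩
      · exact hb γ ⟨φ, (hsol _).1, rfl, (hsol _).2⟩
    have := hφ 0
    rwa [h0] at this

/-- Limit of a function antitone on part of the half-line and bounded below. -/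
lemma antitone_lim {v : ℝ → ℝ} {S : Set ℝ} (hv : AntitoneOn v (Ici 0 ∩ S))
    (hb : ∀ t ∈ Ici 0 ∩ S, 0 ≤ v t) : ∃ c, Tendsto v (atTop ⊓ 𝓟 S) (𝓝 c) := by
  by_cases hne : (Ici (0:ℝ) ∩ S).Nonempty
  · refine ⟨sInf (v '' (Ici 0 ∩ S)), ?_⟩
    have hbd : BddBelow (v '' (Ici 0 ∩ S)) := ⟨0, by rintro _ ⟨t, ht, rfl⟩; exact hb t ht⟩
    rw [Metric.tendsto_nhds]
    intro ε hε
    obtain ⟨_, ⟨t₀, ht₀, rfl⟩, hlt⟩ := exists_lt_of_csInf_lt (hne.image v)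
      (lt_add_of_pos_right (sInf (v '' (Ici 0 ∩ S))) hε)
    rw [eventually_inf_principal]
    filter_upwards [eventually_ge_atTop t₀] with t ht htS
    have htm : t ∈ Ici 0 ∩ S := ⟨le_trans ht₀.1 ht, htS⟩
    have h1 := hv ht₀ htm ht
    have h2 := csInf_le hbd ⟨t, htm, rfl⟩
    rw [Real.dist_eq, abs_lt]
    constructor <;> linarith
  · refine ⟨0, ?_⟩
    rw [Metric.tendsto_nhds]
    intro ε hε
    rw [eventually_inf_principal]
    filter_upwards [eventually_ge_atTop 0] with t ht htS
    exact absurd ⟨t, ht, htS⟩ hne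

lemma ClassKInf.id : ClassKInf (fun s : ℝ => s) :=
  ⟨⟨continuousOn_id, fun _ _ _ _ h => h, rfl⟩, tendsto_id⟩

lemma ClassK.nonneg {α : ℝ → ℝ} (h : ClassK α) {s : ℝ} (hs : 0 ≤ s) : 0 ≤ α s := by
  have := h.mono.monotoneOn (mem_Ici.2 le_rfl) (mem_Ici.2 hs) hs
  rwa [h.zero] at this

lemma ClassKInf.iter {β : ℝ → ℝ} (h : ClassKInf β) (k : ℕ) : ClassKInf (β^[k]) := by
  induction k with
  | zero => exact ClassKInf.id
  | succ k ih =>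
    rw [Function.iterate_succ']
    have hm : MapsTo β^[k] (Ici 0) (Ici 0) := fun s hs => ih.toClassK.nonneg hs
    exact ⟨⟨h.cont.comp ih.cont hm, h.mono.comp ih.mono hm, by simp [ih.zero, h.zero]⟩,
      h.unbounded.comp ih.unbounded⟩

lemma exists_beta {α₁ α₂ : ℝ → ℝ} (h1 : ClassKInf α₁) (h2 : ClassK α₂) :
    ∃ β, ClassKInf β ∧ (∀ s, 0 ≤ s → s ≤ β s) ∧
      ∀ u s, 0 ≤ u → 0 ≤ s → α₁ u ≤ α₂ s → u ≤ β s := by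
  let g : ℝ → ℝ := fun s => α₁ (max s 0) + min s 0
  have hgm : StrictMono g := by
    intro p q hpq
    simp only [g]
    rcases lt_or_ge q 0 with hq | hq
    · rw [max_eq_right hq.le, max_eq_right (hpq.trans hq).le, min_eq_left hq.le,
        min_eq_left (hpq.trans hq).le]
      linarith
    · rcases lt_or_ge p 0 with hp | hp
      · rw [max_eq_right hp.le, min_eq_left hp.le, max_eq_left hq, min_eq_right hq, h1.zero]
        linarith [h1.toClassK.nonneg hq]
      · rw [max_eq_left hp, min_eq_right hp, max_eq_left hq, min_eq_right hq]
        linarith [h1.mono (mem_Ici.2 hp) (mem_Ici.2 hq) hpq]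
  have hgc : Continuous g := by
    have : Continuous fun s : ℝ => α₁ (max s 0) :=
      h1.cont.comp_continuous (by fun_prop) (fun s => mem_Ici.2 (le_max_right _ _))
    exact this.add (by fun_prop)
  have hgt : Tendsto g atTop atTop := by
    refine h1.unbounded.congr' ?_
    filter_upwards [eventually_ge_atTop 0] with s hs
    simp [g, hs]
  have hgb : Tendsto g atBot atBot := by
    refine tendsto_id.congr' ?_
    filter_upwards [eventually_le_atBot 0] with s hs
    simp [g, hs, h1.zero]
  have hsurj := hgc.surjective hgt hgb
  let e := hgm.orderIsoOfSurjective g hsurj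
  have he : ∀ s, e s = g s := fun s => rfl
  have hesym : Continuous e.symm := e.symm.continuous
  have he0 : e.symm 0 = 0 := by
    rw [OrderIso.symm_apply_eq, he]; simp [g, h1.zero]
  have hpos : ∀ s, 0 ≤ s → 0 ≤ e.symm (α₂ s) := fun s hs => by
    rw [← he0]; exact e.symm.monotone (h2.nonneg hs)
  refine ⟨fun s => e.symm (α₂ s) + s, ⟨⟨?_, ?_, ?_⟩, ?_⟩, ?_, ?_⟩
  · exact (hesym.comp_continuousOn h2.cont).add continuousOn_id
  · intro p hp q hq hpq
    have := e.symm.monotone (h2.mono hp hq hpq).le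
    show e.symm (α₂ p) + p < e.symm (α₂ q) + q
    linarith
  · simp [h2.zero, he0]
  · refine tendsto_atTop_mono' _ ?_ tendsto_id
    filter_upwards [eventually_ge_atTop 0] with s hs
    simpa using hpos s hs
  · intro s hs
    linarith [hpos s hs]
  · intro u s hu hs hus
    have : u ≤ e.symm (α₂ s) := by
      rw [OrderIso.le_symm_apply, he]
      simpa [g, hu] using hus
    linarith

lemma trunc_KInf {α : ℝ → ℝ} (h : ClassK α) {ρ : ℝ} (hρ : 0 < ρ) :
    ClassKInf (fun s => α (min s ρ) + (s - min s ρ)) := by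
  have hmaps : MapsTo (fun s : ℝ => min s ρ) (Ici 0) (Ici 0) := fun s hs => le_min hs hρ.le
  refine ⟨⟨?_, ?_, ?_⟩, ?_⟩
  · exact (h.cont.comp (by fun_prop) hmaps).add (by fun_prop)
  · intro p hp q hq hpq
    show α (min p ρ) + (p - min p ρ) < α (min q ρ) + (q - min q ρ)
    rcases lt_or_ge p ρ with h1 | h1
    · have h2 : min p ρ < min q ρ := by rw [min_eq_left h1.le]; exact lt_min hpq h1
      have h3 := h.mono (hmaps hp) (hmaps hq) h2
      have : p - min p ρ = 0 := by rw [min_eq_left h1.le]; ring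
      linarith [min_le_left q ρ]
    · rw [min_eq_right h1, min_eq_right (h1.trans hpq.le)]; linarith
  · simp [hρ.le, h.zero]
  · refine tendsto_atTop_mono' _ ?_ (tendsto_atTop_add_const_right _ (-ρ) tendsto_id)
    filter_upwards [eventually_ge_atTop 0] with s hs
    have := h.nonneg (hmaps hs)
    simp only [id]
    linarith [min_le_right s ρ]

/-- The multiple Lyapunov function bound. -/
lemma modes_bound {n : ℕ} {Γ : Type*} [MetricSpace Γ] [Finite Γ] {x : ℝ → Eucl n} {σ : ℝ → Γ}
    (hσ : IsSwitchingSignal σ) {β : ℝ → ℝ} (hβ : ClassKInf β) (hid : ∀ s, 0 ≤ s → s ≤ β s)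
    {t₀ b : ℝ} (hx : ContinuousOn x (Icc t₀ b))
    (hdec : ∀ p ∈ Icc t₀ b, ∀ q ∈ Icc t₀ b, p ≤ q → σ p = σ q → ‖x q‖ ≤ β ‖x p‖) :
    ∀ t ∈ Icc t₀ b, ‖x t‖ ≤ β^[Nat.card Γ] ‖x t₀‖ := by
  have main : ∀ k : ℕ, ∀ t ∈ Icc t₀ b, (σ '' Icc t₀ t).ncard ≤ k → ‖x t‖ ≤ β^[k] ‖x t₀‖ := by
    intro k
    induction k with
    | zero =>
      intro t ht hk
      exfalso
      have h1 : (σ '' Icc t₀ t).Nonempty := ⟨_, t, ⟨ht.1, le_rfl⟩, rfl⟩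
      rw [Nat.le_zero, ncard_eq_zero] at hk
      exact h1.ne_empty hk
    | succ k ih =>
      intro t ht hk
      -- first activation time of the mode `σ t`
      let A := {s | s ∈ Icc t₀ t ∧ σ s = σ t}
      have hAne : A.Nonempty := ⟨t, ⟨ht.1, le_rfl⟩, rfl⟩
      have hAbd : BddBelow A := ⟨t₀, fun s hs => hs.1.1⟩
      set t₁ := sInf A with ht₁
      have h01 : t₀ ≤ t₁ := le_csInf hAne fun s hs => hs.1.1
      have h1t : t₁ ≤ t := csInf_le hAbd ⟨⟨ht.1, le_rfl⟩, rfl⟩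
      have hmem1 : t₁ ∈ Icc t₀ b := ⟨h01, h1t.trans ht.2⟩
      have hσ1 : σ t₁ = σ t := by
        obtain ⟨ε, hε, hr⟩ := hσ.rightConst t₁
        obtain ⟨s, hs, hlt⟩ := exists_lt_of_csInf_lt hAne (show sInf A < t₁ + ε by linarith)
        rw [← hs.2]
        exact (hr s ⟨csInf_le hAbd hs, hlt⟩).symm
      have hd := hdec t₁ hmem1 t ht h1t hσ1
      have hnn : ‖x t₀‖ ∈ Ici (0:ℝ) := norm_nonneg _
      have hbound : ‖x t₁‖ ≤ β^[k] ‖x t₀‖ := by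
        rcases eq_or_lt_of_le h01 with heq | hlt
        · rw [← heq]
          clear * - hid hβ
          induction k with
          | zero => simp
          | succ k ih =>
            rw [Function.iterate_succ_apply']
            exact ih.trans (hid _ ((norm_nonneg _).trans ih))
        · have hbef : ∀ s ∈ Ico t₀ t₁, ‖x s‖ ≤ β^[k] ‖x t₀‖ := by
            intro s hs
            refine ih s ⟨hs.1, hs.2.le.trans hmem1.2⟩ ?_
            have hss : σ '' Icc t₀ s ⊂ σ '' Icc t₀ t := by
              refine ⟨image_mono (Icc_subset_Icc_right (hs.2.le.trans h1t)), fun hsub => ?_⟩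
              obtain ⟨w, hw, hwe⟩ := hsub ⟨t, ⟨ht.1, le_rfl⟩, rfl⟩
              have : t₁ ≤ w := csInf_le hAbd ⟨⟨hw.1, hw.2.trans (hs.2.le.trans h1t)⟩, hwe⟩
              linarith [hw.2, hs.2]
            have := ncard_lt_ncard hss (toFinite _)
            omega
          have hcl : t₁ ∈ closure (Ico t₀ t₁) := by
            rw [closure_Ico hlt.ne]; exact ⟨h01, le_rfl⟩
          have hcw : ContinuousWithinAt (fun s => ‖x s‖) (Ico t₀ t₁) t₁ :=
            ((hx t₁ hmem1).mono fun s hs => ⟨hs.1, hs.2.le.trans hmem1.2⟩).norm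
          have : (𝓝[Ico t₀ t₁] t₁).NeBot := mem_closure_iff_nhdsWithin_neBot.1 hcl
          exact le_of_tendsto hcw (by
            filter_upwards [self_mem_nhdsWithin] with s hs using hbef s hs)
      rw [Function.iterate_succ_apply']
      exact hd.trans (hβ.mono.monotoneOn (mem_Ici.2 (norm_nonneg _))
        (mem_Ici.2 ((hβ.iter k).toClassK.nonneg hnn)) hbound)
  intro t ht
  refine main _ t ht ?_
  exact ncard_le_card _

end

noncomputable section

lemma WeakLyapunovPair.toF {n : ℕ} {Γ : Type*} [TopologicalSpace Γ]
    {f : Eucl n × Γ → Eucl n} {domf : Set (Eucl n × Γ)} {V : Eucl n × Γ → ℝ}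
    {domV : Set (Eucl n × Γ)} {W : Eucl n × Γ → ℝ}
    {T : Set ((ℝ → Eucl n) × (ℝ → Γ))} (h : WeakLyapunovPair f domf V domV W T) :
    FWeakLyapunovPair f domf V domV W T := by
  refine ⟨h.classV, h.zeroMem, h.bounds, h.wineq, ?_⟩
  intro xs hxs a b ha hab hO γ p hp q hq hpq
  have := h.decreasing xs hxs a b ha hab hO hp.1 hq.1 hpq
  have h1 : xs.2 p = γ := hp.2
  have h2 : xs.2 q = γ := hq.2
  simpa only [h1, h2] using this

/-- Attractivity of bounded stable trajectories (a property of the family `T`). -/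
def Attr {n : ℕ} {Γ : Type*} (domV : Set (Eucl n × Γ)) (T : Set ((ℝ → Eucl n) × (ℝ → Γ))) :
    Prop :=
  ∀ xs ∈ T, ∀ R : ℝ, Metric.closedBall (0 : Eucl n) R ⊆ Oset domV →
    (∀ t, 0 ≤ t → xs.1 t ∈ Metric.closedBall (0 : Eucl n) R) →
    (∀ ε > (0:ℝ), ∃ δ > (0:ℝ), ∀ t₀, 0 ≤ t₀ → ‖xs.1 t₀‖ < δ → ∀ t, t₀ ≤ t → ‖xs.1 t‖ < ε) →
    Tendsto xs.1 atTop (𝓝 0)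

lemma small_of_classK {α : ℝ → ℝ} (h : ClassK α) {r ε : ℝ} (hr : 0 < r) (hε : 0 < ε) :
    ∃ δ > (0:ℝ), δ ≤ r ∧ ∀ s, 0 ≤ s → s ≤ δ → α s < ε := by
  have h1 := Metric.continuousOn_iff.1 h.cont 0 (mem_Ici.2 le_rfl) ε hε
  obtain ⟨δ, hδ, h2⟩ := h1
  refine ⟨min r (δ/2), lt_min hr (by positivity), min_le_left _ _, fun s hs hs2 => ?_⟩
  have := h2 s hs (by
    rw [Real.dist_eq, sub_zero, abs_of_nonneg hs]
    linarith [min_le_right r (δ/2)])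
  rw [Real.dist_eq, h.zero, sub_zero] at this
  exact (le_abs_self _).trans_lt this

section
variable {n : ℕ} {Γ : Type*} [MetricSpace Γ] [Finite Γ]
    {f : Eucl n × Γ → Eucl n} {domf : Set (Eucl n × Γ)}
    {T : Set ((ℝ → Eucl n) × (ℝ → Γ))} {V : Eucl n × Γ → ℝ}
    {domV : Set (Eucl n × Γ)} {W : Eucl n × Γ → ℝ}

lemma traj_antitone (hT : ForwardCompleteFamily f domf T)
    (hF : FWeakLyapunovPair f domf V domV W T) {xs : (ℝ → Eucl n) × (ℝ → Γ)} (hxs : xs ∈ T)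
    (hO : ∀ t, 0 ≤ t → xs.1 t ∈ Oset domV) (γ : Γ) :
    AntitoneOn (fun t => V (xs.1 t, γ)) (Ici 0 ∩ {t | xs.2 t = γ}) ∧
    ∀ t ∈ Ici 0 ∩ {t | xs.2 t = γ}, 0 ≤ V (xs.1 t, γ) := by
  constructor
  · intro p hp q hq hpq
    have hp0 : 0 ≤ p := hp.1
    exact hF.decreasing xs hxs p q hp0 hpq (fun t ht => hO t (hp0.trans ht.1)) γ
      ⟨⟨le_rfl, hpq⟩, hp.2⟩ ⟨⟨hpq, le_rfl⟩, hq.2⟩ hpq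
  · intro t ht
    obtain ⟨I, hI, htr⟩ := hT xs hxs
    obtain ⟨α₁, α₂, h1, h2, hb⟩ := hF.bounds
    have hm := htr.mem t (hI ht.1)
    rw [show xs.2 t = γ from ht.2] at hm
    exact (h1.nonneg (norm_nonneg _)).trans (hb γ _ ⟨hO t ht.1, hm⟩).1

lemma attr_F (hdomf : IsClosed domf) (hf : ContinuousOn f domf) (H : Γ → Set Γ)
    (hT : ForwardCompleteFamily f domf T) (hTσ : ∀ xs ∈ T, xs.2 ∈ SDall Γ ∩ SH H)
    (hF : FWeakLyapunovPair f domf V domV W T) (hCI : CondI f domf domV W)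
    (hcyc : CondCycle f domf domV W H) : Attr domV T := by
  intro xs hxs R hR hx hstab
  obtain ⟨I, hI, htr⟩ := hT xs hxs
  have hlim : ∀ γ, ∃ c, Tendsto (fun t => V (xs.1 t, γ)) (atTop ⊓ 𝓟 {t | xs.2 t = γ}) (𝓝 c) :=
    fun γ => by
      obtain ⟨h1, h2⟩ := traj_antitone hT hF hxs (fun t ht => hR (hx t ht)) γ
      exact antitone_lim h1 h2
  choose c hc using hlim
  refine attract hdomf hf htr hI (isCompact_closedBall 0 R) hx hR hF.classV hF.wineq H
    (hTσ xs hxs) c hc hCI ?_ hstab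
  intro m γs hs
  obtain ⟨j, hj1, hj2, hj⟩ := hcyc m γs hs
  exact ⟨j, hj1, hj2, fun ξ hξ => hj hξ.1.1⟩

lemma attr_W (hdomf : IsClosed domf) (hf : ContinuousOn f domf) (H : Γ → Set Γ)
    (hT : ForwardCompleteFamily f domf T) (hTσ : ∀ xs ∈ T, xs.2 ∈ SDall Γ ∩ SH H)
    (hL : WeakLyapunovPair f domf V domV W T) (hCI : CondI f domf domV W)
    (hcyc : CondCycle' f V domf domV W H) : Attr domV T := by
  intro xs hxs R hR hx hstab
  obtain ⟨I, hI, htr⟩ := hT xs hxs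
  have hlim : ∃ c, Tendsto (fun t => V (xs.1 t, xs.2 t)) (atTop ⊓ 𝓟 univ) (𝓝 c) := by
    refine antitone_lim ?_ ?_
    · intro p hp q hq hpq
      have hp0 : 0 ≤ p := hp.1
      exact hL.decreasing xs hxs p q hp0 hpq (fun t ht => hR (hx t (hp0.trans ht.1)))
        ⟨le_rfl, hpq⟩ ⟨hpq, le_rfl⟩ hpq
    · intro t ht
      exact (traj_antitone hT hL.toF hxs (fun t ht => hR (hx t ht)) (xs.2 t)).2 t ⟨ht.1, rfl⟩
  obtain ⟨c, hc⟩ := hlim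
  rw [principal_univ, inf_top_eq] at hc
  refine attract hdomf hf htr hI (isCompact_closedBall 0 R) hx hR hL.classV hL.wineq H
    (hTσ xs hxs) (fun _ => c) (fun γ => ?_) hCI (fun m γs hs => hcyc c m γs hs) hstab
  refine (hc.mono_left inf_le_left).congr' ?_
  have : ∀ᶠ t in atTop ⊓ 𝓟 {t | xs.2 t = γ}, xs.2 t = γ :=
    eventually_inf_principal.2 (Eventually.of_forall fun t ht => ht)
  filter_upwards [this] with t ht
  rw [ht]

/-- Bound on intervals on which the trajectory remains in `S ⊆ O`. -/
lemma traj_bound (hT : ForwardCompleteFamily f domf T)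
    (hF : FWeakLyapunovPair f domf V domV W T) {α₁ α₂ : ℝ → ℝ}
    (S : Set (Eucl n)) (hS : S ⊆ Oset domV)
    (hb : ∀ γ : Γ, ∀ ξ ∈ Ogamma domV domf γ, ξ ∈ S → α₁ ‖ξ‖ ≤ V (ξ, γ) ∧ V (ξ, γ) ≤ α₂ ‖ξ‖)
    {β : ℝ → ℝ} (hβ : ClassKInf β) (hid : ∀ s, 0 ≤ s → s ≤ β s)
    (hinv : ∀ u s, 0 ≤ u → 0 ≤ s → α₁ u ≤ α₂ s → u ≤ β s)
    {xs : (ℝ → Eucl n) × (ℝ → Γ)} (hxs : xs ∈ T) {t₀ b : ℝ} (ht₀ : 0 ≤ t₀)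
    (hin : ∀ t ∈ Icc t₀ b, xs.1 t ∈ S) :
    ∀ t ∈ Icc t₀ b, ‖xs.1 t‖ ≤ β^[Nat.card Γ] ‖xs.1 t₀‖ := by
  obtain ⟨I, hI, htr⟩ := hT xs hxs
  have hII : Icc t₀ b ⊆ I := fun t ht => hI (ht₀.trans ht.1)
  refine modes_bound htr.signal hβ hid (htr.cont.mono hII) ?_
  intro p hp q hq hpq hσ
  refine hinv _ _ (norm_nonneg _) (norm_nonneg _) ?_
  have hmp := htr.mem p (hII hp)
  have hmq := htr.mem q (hII hq)
  rw [← hσ] at hmq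
  have h1 := (hb _ _ ⟨hS (hin p hp), hmp⟩ (hin p hp)).2
  have h2 := (hb _ _ ⟨hS (hin q hq), hmq⟩ (hin q hq)).1
  have h3 := hF.decreasing xs hxs p q (ht₀.trans hp.1) hpq
    (fun t ht => hS (hin t ⟨hp.1.trans ht.1, ht.2.trans hq.2⟩)) (xs.2 p)
    ⟨⟨le_rfl, hpq⟩, rfl⟩ ⟨⟨hpq, le_rfl⟩, hσ.symm⟩ hpq
  exact h2.trans (h3.trans h1)

lemma las_core (hT : ForwardCompleteFamily f domf T)
    (hF : FWeakLyapunovPair f domf V domV W T) (hA : Attr domV T) : FamilyLAS T := by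
  have hOo : IsOpen (Oset domV) := by
    have : Oset domV = ⋃ γ : Γ, {ξ : Eucl n | (ξ, γ) ∈ domV} := by
      ext ξ; simp [Oset]
    rw [this]
    exact isOpen_iUnion hF.classV.openD
  obtain ⟨ρ, hρ, hball⟩ := Metric.nhds_basis_closedBall.mem_iff.1 (hOo.mem_nhds hF.zeroMem)
  obtain ⟨α₁, α₂, h1, h2, hb⟩ := hF.bounds
  obtain ⟨β, hβ, hid, hinv⟩ := exists_beta (trunc_KInf h1 hρ) h2
  have hK := hβ.iter (Nat.card Γ)
  obtain ⟨r, hr, -, hsmall⟩ := small_of_classK hK.toClassK one_pos hρ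
  have hbd : ∀ xs ∈ T, ∀ t₀ b : ℝ, 0 ≤ t₀ → (∀ t ∈ Icc t₀ b, ‖xs.1 t‖ ≤ ρ) →
      ∀ t ∈ Icc t₀ b, ‖xs.1 t‖ ≤ β^[Nat.card Γ] ‖xs.1 t₀‖ := by
    intro xs hxs t₀ b ht₀ hin
    refine traj_bound hT hF (Metric.closedBall 0 ρ) hball ?_ hβ hid hinv hxs ht₀ ?_
    · intro γ ξ hξ hξρ
      have hn : ‖ξ‖ ≤ ρ := by simpa using hξρ
      have := hb γ ξ hξ
      simpa [min_eq_left hn] using this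
    · intro t ht; simpa using hin t ht
  have hstay : ∀ xs ∈ T, ∀ t₀ : ℝ, 0 ≤ t₀ → ‖xs.1 t₀‖ ≤ r → ∀ t, t₀ ≤ t → ‖xs.1 t‖ ≤ ρ := by
    intro xs hxs t₀ ht₀ hxr t ht
    by_contra hcon
    push Not at hcon
    obtain ⟨I, hI, htr⟩ := hT xs hxs
    have hcont : ContinuousOn (fun s => ‖xs.1 s‖) (Icc t₀ t) :=
      (htr.cont.mono fun s hs => hI (ht₀.trans hs.1)).norm
    -- first time at which the norm reaches ρ
    have hAc : IsClosed (Icc t₀ t ∩ (fun s => ‖xs.1 s‖) ⁻¹' Ici ρ) :=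
      hcont.preimage_isClosed_of_isClosed isClosed_Icc isClosed_Ici
    have hAk : IsCompact (Icc t₀ t ∩ (fun s => ‖xs.1 s‖) ⁻¹' Ici ρ) :=
      isCompact_Icc.of_isClosed_subset hAc inter_subset_left
    obtain ⟨w, hw, hmin⟩ := hAk.exists_isLeast ⟨t, ⟨ht, le_rfl⟩, hcon.le⟩
    have hlt : ∀ s ∈ Ico t₀ w, ‖xs.1 s‖ ≤ ρ := by
      intro s hs
      by_contra hc
      push Not at hc
      have := hmin ⟨⟨hs.1, hs.2.le.trans hw.1.2⟩, hc.le⟩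
      linarith [hs.2]
    have hw2 : ρ ≤ ‖xs.1 w‖ := hw.2
    have h0 : ‖xs.1 t₀‖ < ρ :=
      lt_of_le_of_lt (by
        have := hbd xs hxs t₀ t₀
        have hk : ∀ k : ℕ, ‖xs.1 t₀‖ ≤ β^[k] ‖xs.1 t₀‖ := by
          intro k
          induction k with
          | zero => simp
          | succ k ih =>
            rw [Function.iterate_succ_apply']
            exact ih.trans (hid _ ((norm_nonneg _).trans ih))
        exact hk (Nat.card Γ)) (hsmall _ (norm_nonneg _) hxr)
    have htw : t₀ < w := lt_of_le_of_ne hw.1.1 (by rintro rfl; linarith)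
    have hle : ‖xs.1 w‖ ≤ ρ := by
      have hcl : w ∈ closure (Ico t₀ w) := by
        rw [closure_Ico htw.ne]; exact ⟨htw.le, le_rfl⟩
      have : (𝓝[Ico t₀ w] w).NeBot := mem_closure_iff_nhdsWithin_neBot.1 hcl
      have hsub : Ico t₀ w ⊆ Icc t₀ t := fun s hs => ⟨hs.1, hs.2.le.trans hw.1.2⟩
      exact le_of_tendsto ((hcont w hw.1).mono hsub) (by
        filter_upwards [self_mem_nhdsWithin] with s hs using hlt s hs)
    have := hbd xs hxs t₀ w ht₀ (fun s hs => by
      rcases eq_or_lt_of_le hs.2 with h | h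
      · rw [h]; exact hle
      · exact hlt s ⟨hs.1, h⟩) w ⟨htw.le, le_rfl⟩
    linarith [hsmall _ (norm_nonneg _) hxr]
  have hLUS : ∀ xs ∈ T, ∀ t₀ : ℝ, 0 ≤ t₀ → ‖xs.1 t₀‖ ≤ r → ∀ t, t₀ ≤ t →
      ‖xs.1 t‖ ≤ β^[Nat.card Γ] ‖xs.1 t₀‖ := fun xs hxs t₀ ht₀ hxr t ht =>
    hbd xs hxs t₀ t ht₀ (fun s hs => hstay xs hxs t₀ ht₀ hxr s hs.1) t ⟨ht, le_rfl⟩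
  refine ⟨⟨r, hr, _, hK.toClassK, hLUS⟩, r, hr, fun xs hxs hx0 => ?_⟩
  refine hA xs hxs ρ hball (fun t ht => ?_) (fun ε hε => ?_)
  · simpa using hstay xs hxs 0 le_rfl hx0.le t ht
  · obtain ⟨δ, hδ, hδr, hs⟩ := small_of_classK hK.toClassK hr hε
    exact ⟨δ, hδ, fun t₀ ht₀ hx t ht => (hLUS xs hxs t₀ ht₀ (hx.le.trans hδr) t ht).trans_lt
      (hs _ (norm_nonneg _) hx.le)⟩

lemma gas_core (hT : ForwardCompleteFamily f domf T)
    (hF : FWeakLyapunovPair f domf V domV W T) (hO : Oset domV = univ)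
    (hR : RadiallyUnbounded V domV domf) (hA : Attr domV T) : FamilyGAS T := by
  obtain ⟨α₁, α₂, h1, h2, hb⟩ := hR
  obtain ⟨β, hβ, hid, hinv⟩ := exists_beta h1 h2.toClassK
  have hK := hβ.iter (Nat.card Γ)
  have hGUS : ∀ xs ∈ T, ∀ t₀ : ℝ, 0 ≤ t₀ → ∀ t, t₀ ≤ t →
      ‖xs.1 t‖ ≤ β^[Nat.card Γ] ‖xs.1 t₀‖ := fun xs hxs t₀ ht₀ t ht =>
    traj_bound hT hF univ hO.ge (fun γ ξ hξ _ => hb γ ξ hξ) hβ hid hinv hxs ht₀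
      (fun _ _ => mem_univ _) t ⟨ht, le_rfl⟩
  refine ⟨⟨_, hK, hGUS⟩, fun xs hxs => ?_⟩
  refine hA xs hxs (β^[Nat.card Γ] ‖xs.1 0‖) (by rw [hO]; exact subset_univ _)
    (fun t ht => ?_) (fun ε hε => ?_)
  · simpa using hGUS xs hxs 0 le_rfl t ht
  · obtain ⟨δ, hδ, -, hs⟩ := small_of_classK hK.toClassK one_pos hε
    exact ⟨δ, hδ, fun t₀ ht₀ hx t ht => (hGUS xs hxs t₀ ht₀ t ht).trans_lt
      (hs _ (norm_nonneg _) hx.le)⟩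

end

end

noncomputable section
theorem stability_criteria_cycles
    {n : ℕ} {Γ : Type*} [MetricSpace Γ] [Finite Γ]
    (f : Eucl n × Γ → Eucl n) (domf : Set (Eucl n × Γ))
    (hdomf : IsClosed domf) (hf : ContinuousOn f domf)
    (hE0 : AssumpE0 f domf)
    (H : Γ → Set Γ)
    (T : Set ((ℝ → Eucl n) × (ℝ → Γ)))
    (hT : ForwardCompleteFamily f domf T)
    (hTσ : ∀ xs ∈ T, xs.2 ∈ SDall Γ ∩ SH H) :
    ((∃ V : Eucl n × Γ → ℝ, ∃ domV : Set (Eucl n × Γ), ∃ W : Eucl n × Γ → ℝ,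
        WeakLyapunovPair f domf V domV W T ∧
        CondI f domf domV W ∧ CondCycle' f V domf domV W H) → FamilyLAS T) ∧
    ((∃ V : Eucl n × Γ → ℝ, ∃ domV : Set (Eucl n × Γ), ∃ W : Eucl n × Γ → ℝ,
        FWeakLyapunovPair f domf V domV W T ∧
        CondI f domf domV W ∧ CondCycle f domf domV W H) → FamilyLAS T) ∧
    ((∃ V : Eucl n × Γ → ℝ, ∃ domV : Set (Eucl n × Γ), ∃ W : Eucl n × Γ → ℝ,
        WeakLyapunovPair f domf V domV W T ∧
        CondI f domf domV W ∧ CondCycle' f V domf domV W H ∧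
        Oset domV = Set.univ ∧ RadiallyUnbounded V domV domf) → FamilyGAS T) ∧
    ((∃ V : Eucl n × Γ → ℝ, ∃ domV : Set (Eucl n × Γ), ∃ W : Eucl n × Γ → ℝ,
        FWeakLyapunovPair f domf V domV W T ∧
        CondI f domf domV W ∧ CondCycle f domf domV W H ∧
        Oset domV = Set.univ ∧ RadiallyUnbounded V domV domf) → FamilyGAS T) := by
  refine ⟨?_, ?_, ?_, ?_⟩
  · rintro ⟨V, domV, W, hL, hCI, hc⟩
    exact las_core hT hL.toF (attr_W hdomf hf H hT hTσ hL hCI hc)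
  · rintro ⟨V, domV, W, hL, hCI, hc⟩
    exact las_core hT hL (attr_F hdomf hf H hT hTσ hL hCI hc)
  · rintro ⟨V, domV, W, hL, hCI, hc, hO, hR⟩
    exact gas_core hT hL.toF hO hR (attr_W hdomf hf H hT hTσ hL hCI hc)
  · rintro ⟨V, domV, W, hL, hCI, hc, hO, hR⟩
    exact gas_core hT hL hO hR (attr_F hdomf hf H hT hTσ hL hCI hc)
end
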